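/- Let 𝕀 be an interface and D the dependency relation induced by 𝕀. If p ≼^𝕀 q, s ∈ tr(q), and p ⇓ [s]_D, then there exists s' ∈ [s]_D such that s' ∈ tr(p). -/

import Mathlib

/-!
Common definitions: sequential CCS with success, configurations,
must testing, Mazurkiewicz traces, filtered traces, interfaces, and
the classical / uncoordinated / individualistic must preorders.
-/

namespace MultipartyTesting

/-- Actions: input or output over a name. -/
inductive Act (Name : Type) : Type where
  | inp : Name → Act Name
  | out : Name → Act Name

/-- Complementation of actions (involutive). -/
def Act.co {Name : Type} : Act Name → Act Name
  | .inp a => .out a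
  | .out a => .inp a

/-- Transition labels: visible actions, the internal action τ, and success ✓. -/
inductive Label (Name : Type) : Type where
  | act : Act Name → Label Name
  | tau : Label Name
  | tick : Label Name

/-- Sequential CCS with success (recursion via de Bruijn indices):
`p ::= 0 | 1 | μ.p | p+q | X | rec_X. p` where prefixes are actions (`pre`) or τ (`tpre`). -/
inductive Proc (Name : Type) : Type where
  | nil : Proc Name
  | one : Proc Name
  | pre : Act Name → Proc Name → Proc Name
  | tpre : Proc Name → Proc Name
  | choice : Proc Name → Proc Name → Proc Name
  | var : ℕ → Proc Name
  | fix : Proc Name → Proc Name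

namespace Proc

variable {Name : Type}

/-- de Bruijn lifting. -/
def lift (d : ℕ) : Proc Name → Proc Name
  | nil => nil
  | one => one
  | pre a p => pre a (lift d p)
  | tpre p => tpre (lift d p)
  | choice p q => choice (lift d p) (lift d q)
  | var k => if k < d then var k else var (k + 1)
  | fix p => fix (lift (d + 1) p)

/-- Substitution of `u` for de Bruijn index `d`. -/
def subst (d : ℕ) (u : Proc Name) : Proc Name → Proc Name
  | nil => nil
  | one => one
  | pre a p => pre a (subst d u p)
  | tpre p => tpre (subst d u p)
  | choice p q => choice (subst d u p) (subst d u q)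
  | var k => if k = d then u else if k < d then var k else var (k - 1)
  | fix p => fix (subst (d + 1) (lift 0 u) p)

/-- The set of actions occurring in a process (so `α` or `ᾱ` occurs in `p`
iff the corresponding name is in `n(p)`). -/
def acts : Proc Name → Set (Act Name)
  | nil => ∅
  | one => ∅
  | pre a p => insert a (acts p)
  | tpre p => acts p
  | choice p q => acts p ∪ acts q
  | var _ => ∅
  | fix p => acts p

end Proc

/-- The LTS on sequential processes. -/
inductive Step {Name : Type} : Proc Name → Label Name → Proc Name → Prop where
  | one : Step Proc.one Label.tick Proc.nil
  | pre (a : Act Name) (p : Proc Name) : Step (Proc.pre a p) (Label.act a) p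
  | tpre (p : Proc Name) : Step (Proc.tpre p) Label.tau p
  | choiceL {p l p'} (q) : Step p l p' → Step (Proc.choice p q) l p'
  | choiceR {q l q'} (p) : Step q l q' → Step (Proc.choice p q) l q'
  | fix {p l p'} : Step (Proc.subst 0 (Proc.fix p) p) l p' → Step (Proc.fix p) l p'

/-- Configurations: parallel compositions of processes; additionally
`hide V c` is the projection `c↾V` that hides (turns into τ) every action not in `V`. -/
inductive Conf (Name : Type) : Type where
  | proc : Proc Name → Conf Name
  | par : Conf Name → Conf Name → Conf Name
  | hide : Set (Act Name) → Conf Name → Conf Name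

/-- Pure configurations: parallel compositions of processes (no hiding),
i.e. the configurations of the paper. -/
inductive Conf.Pure {Name : Type} : Conf Name → Prop where
  | proc (p : Proc Name) : Pure (Conf.proc p)
  | par {c d} : Pure c → Pure d → Pure (Conf.par c d)

/-- The LTS on configurations: interleaving of non-✓ labels, synchronization of
complementary actions into τ, simultaneous ✓, and the projection rules. -/
inductive CStep {Name : Type} : Conf Name → Label Name → Conf Name → Prop where
  | proc {p l p'} : Step p l p' → CStep (Conf.proc p) l (Conf.proc p')
  | parL {c l c'} (d) : CStep c l c' → l ≠ Label.tick →
      CStep (Conf.par c d) l (Conf.par c' d)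
  | parR {d l d'} (c) : CStep d l d' → l ≠ Label.tick →
      CStep (Conf.par c d) l (Conf.par c d')
  | sync {c a c' d d'} : CStep c (Label.act a) c' → CStep d (Label.act (Act.co a)) d' →
      CStep (Conf.par c d) Label.tau (Conf.par c' d')
  | tick {c c' d d'} : CStep c Label.tick c' → CStep d Label.tick d' →
      CStep (Conf.par c d) Label.tick (Conf.par c' d')
  | hideV {V : Set (Act Name)} {c a c'} : CStep c (Label.act a) c' → a ∈ V →
      CStep (Conf.hide V c) (Label.act a) (Conf.hide V c')
  | hideH {V : Set (Act Name)} {c a c'} : CStep c (Label.act a) c' → a ∉ V →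
      CStep (Conf.hide V c) Label.tau (Conf.hide V c')
  | hideT {V : Set (Act Name)} {c c'} : CStep c Label.tau c' →
      CStep (Conf.hide V c) Label.tau (Conf.hide V c')

variable {Name : Type}

/-- Weak internal transitions `c ⇒ c'`. -/
def WTau : Conf Name → Conf Name → Prop :=
  Relation.ReflTransGen (fun c c' => CStep c Label.tau c')

/-- Weak visible transition `c ⇒^a c'`. -/
def WAct (c : Conf Name) (a : Act Name) (c' : Conf Name) : Prop :=
  ∃ c₁ c₂, WTau c c₁ ∧ CStep c₁ (Label.act a) c₂ ∧ WTau c₂ c'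

/-- Weak string transition `c ⇒^s c'` for `s ∈ Act*`. -/
inductive WString : Conf Name → List (Act Name) → Conf Name → Prop where
  | nil {c c'} : WTau c c' → WString c [] c'
  | cons {c a c₁ s c'} : WAct c a c₁ → WString c₁ s c' → WString c (a :: s) c'

/-- Traces of a configuration (restricted to strings over `Act`). -/
def Tr (c : Conf Name) : Set (List (Act Name)) := {s | ∃ c', WString c s c'}

/-- Divergence: an infinite sequence of τ-transitions. -/
def Div (c : Conf Name) : Prop :=
  ∃ f : ℕ → Conf Name, f 0 = c ∧ ∀ n, CStep (f n) Label.tau (f (n + 1))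

/-- Convergence. -/
def Conv (c : Conf Name) : Prop := ¬ Div c

/-- Convergence along a string: `c ⇓ s`. -/
def ConvS : Conf Name → List (Act Name) → Prop
  | c, [] => Conv c
  | c, a :: s => Conv c ∧ ∀ c', WAct c a c' → ConvS c' s

/-- `c MUST L`. -/
def MUSTone (c : Conf Name) (L : Set (Act Name)) : Prop :=
  ∀ c', WTau c c' → ∃ a ∈ L, ∃ c'', WAct c' a c''

/-- `P MUST L` for a set of configurations. -/
def MUSTset (P : Set (Conf Name)) (L : Set (Act Name)) : Prop :=
  ∀ c ∈ P, MUSTone c L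

/-- Residuals: `(c after s)`. -/
def after (c : Conf Name) (s : List (Act Name)) : Set (Conf Name) :=
  {c' | WString c s c'}

/-- `c must o`: every maximal τ-computation of `c ‖ o` (tracked componentwise)
contains a state whose observer component has a ✓-transition. -/
def MustPass (c o : Conf Name) : Prop :=
  ∀ cs os : ℕ → Conf Name, cs 0 = c → os 0 = o →
    ((∀ k, CStep (Conf.par (cs k) (os k)) Label.tau (Conf.par (cs (k + 1)) (os (k + 1)))) →
       ∃ j, ∃ o', CStep (os j) Label.tick o') ∧
    (∀ n : ℕ,
       (∀ k < n, CStep (Conf.par (cs k) (os k)) Label.tau (Conf.par (cs (k + 1)) (os (k + 1)))) →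
       (¬ ∃ d, CStep (Conf.par (cs n) (os n)) Label.tau d) →
       ∃ j ≤ n, ∃ o', CStep (os j) Label.tick o')

/-- The classical must preorder `p ⊑_must q` (observers are all configurations
of the paper, i.e. pure configurations). -/
def MustLeq (p q : Proc Name) : Prop :=
  ∀ o : Conf Name, o.Pure → MustPass (Conf.proc p) o → MustPass (Conf.proc q) o

/-- An interface: a partition `{I_i}_{i ∈ 0..n}` of `Act` closed under complementation. -/
structure Interface (Name : Type) (n : ℕ) where
  part : Fin (n + 1) → Set (Act Name)
  cover : ∀ a, ∃ i, a ∈ part i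
  disjoint : ∀ i j, i ≠ j → ∀ a, a ∈ part i → a ∉ part j
  nonempty : ∀ i, (part i).Nonempty
  coClosed : ∀ i a, a ∈ part i → Act.co a ∈ part i

/-- `o₀ ‖ o₁ ‖ … ‖ o_n` as a configuration. -/
def parOfList (p : Proc Name) : List (Proc Name) → Conf Name
  | [] => Conf.proc p
  | q :: qs => Conf.par (Conf.proc p) (parOfList q qs)

/-- The parallel composition of an indexed family of processes. -/
def parComp {n : ℕ} (os : Fin (n + 1) → Proc Name) : Conf Name :=
  parOfList (os 0) (List.ofFn fun i : Fin n => os i.succ)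

/-- The uncoordinated must preorder `p ⊑^𝕀_unc q`. -/
def UncLeq {n : ℕ} (𝕀 : Interface Name n) (p q : Proc Name) : Prop :=
  ∀ os : Fin (n + 1) → Proc Name, (∀ i, Proc.acts (os i) ⊆ 𝕀.part i) →
    MustPass (Conf.proc p) (parComp os) → MustPass (Conf.proc q) (parComp os)

/-- The individualistic must preorder `p ⊑^𝕀_ind q`. -/
def IndLeq {n : ℕ} (𝕀 : Interface Name n) (p q : Proc Name) : Prop :=
  ∀ os : Fin (n + 1) → Proc Name, (∀ i, Proc.acts (os i) ⊆ 𝕀.part i) →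
    ∀ i, MustPass (Conf.hide (𝕀.part i) (Conf.proc p)) (Conf.proc (os i)) →
         MustPass (Conf.hide (𝕀.part i) (Conf.proc q)) (Conf.proc (os i))

/-- One swap of adjacent independent actions (w.r.t. a dependency relation `D`). -/
inductive SwapStep (D : Set (Act Name × Act Name)) :
    List (Act Name) → List (Act Name) → Prop where
  | swap (u v : List (Act Name)) (a b : Act Name) :
      (a, b) ∉ D → SwapStep D (u ++ a :: b :: v) (u ++ b :: a :: v)

/-- Mazurkiewicz trace equivalence `≡_D`: the least congruence on `Act*`
with `αβ ≡ βα` whenever `(α,β) ∉ D`. -/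
def MEquiv (D : Set (Act Name × Act Name)) : List (Act Name) → List (Act Name) → Prop :=
  Relation.EqvGen (SwapStep D)

/-- The dependency relation induced by an interface: `D = ∪_{I∈𝕀} I×I`. -/
def DepOf {n : ℕ} (𝕀 : Interface Name n) : Set (Act Name × Act Name) :=
  {x | ∃ i, x.1 ∈ 𝕀.part i ∧ x.2 ∈ 𝕀.part i}

/-- `c ⇓ [s]_D`. -/
def ConvMC (c : Conf Name) (D : Set (Act Name × Act Name)) (s : List (Act Name)) : Prop :=
  ∀ t, MEquiv D s t → ConvS c t

/-- `(c after [s]_D)`. -/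
def afterMC (c : Conf Name) (D : Set (Act Name × Act Name)) (s : List (Act Name)) :
    Set (Conf Name) :=
  {c' | ∃ t, MEquiv D s t ∧ WString c t c'}

/-- The trace-based characterisation `p ≼^𝕀 q` of the uncoordinated preorder. -/
def TraceLeqUnc {n : ℕ} (𝕀 : Interface Name n) (p q : Proc Name) : Prop :=
  ∀ (s : List (Act Name)) (i : Fin (n + 1)) (L : Set (Act Name)),
    L.Finite → L ⊆ 𝕀.part i → ConvMC (Conf.proc p) (DepOf 𝕀) s →
      ConvMC (Conf.proc q) (DepOf 𝕀) s ∧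
      (MUSTset (afterMC (Conf.proc p) (DepOf 𝕀) s) L →
       MUSTset (afterMC (Conf.proc q) (DepOf 𝕀) s) L)

open Classical in
/-- `s↾I`: the subsequence of `s` consisting of its symbols in `I`. -/
noncomputable def fproj (I : Set (Act Name)) (s : List (Act Name)) : List (Act Name) :=
  s.filter fun a => decide (a ∈ I)

/-- `c ⇓ ⟨s⟩_I`. -/
def ConvFC (c : Conf Name) (I : Set (Act Name)) (s : List (Act Name)) : Prop :=
  ∀ t, fproj I t = fproj I s → ConvS c t

/-- `(c after ⟨s⟩_I)`. -/
def afterFC (c : Conf Name) (I : Set (Act Name)) (s : List (Act Name)) :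
    Set (Conf Name) :=
  {c' | ∃ t, fproj I t = fproj I s ∧ WString c t c'}

/-- The filtered-trace characterisation `p ≼^𝕀_flt q` of the individualistic preorder. -/
def TraceLeqInd {n : ℕ} (𝕀 : Interface Name n) (p q : Proc Name) : Prop :=
  ∀ (i : Fin (n + 1)) (s : List (Act Name)), (∀ a ∈ s, a ∈ 𝕀.part i) →
    ∀ L : Set (Act Name), L.Finite → L ⊆ 𝕀.part i →
      ConvFC (Conf.proc p) (𝕀.part i) s →
        ConvFC (Conf.proc q) (𝕀.part i) s ∧
        (MUSTset (afterFC (Conf.proc p) (𝕀.part i) s) (L ∪ (𝕀.part i)ᶜ) →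
         MUSTset (afterFC (Conf.proc q) (𝕀.part i) s) (L ∪ (𝕀.part i)ᶜ))

/-- A configuration is unsuccessful if it has no ✓-transition. -/
def Unsucc (c : Conf Name) : Prop := ¬ ∃ c', CStep c Label.tick c'

/-- Unsuccessful weak internal transitions: all states passed through are unsuccessful. -/
inductive UTau : Conf Name → Conf Name → Prop where
  | refl {c} : Unsucc c → UTau c c
  | step {c c₁ c'} : Unsucc c → CStep c Label.tau c₁ → UTau c₁ c' → UTau c c'

/-- Unsuccessful weak visible transition. -/
def UWAct (c : Conf Name) (a : Act Name) (c' : Conf Name) : Prop :=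
  ∃ c₁ c₂, UTau c c₁ ∧ CStep c₁ (Label.act a) c₂ ∧ UTau c₂ c'

/-- Unsuccessful weak string transition (an unsuccessful weak computation `c ⇒^s c'`). -/
inductive UWString : Conf Name → List (Act Name) → Conf Name → Prop where
  | nil {c c'} : UTau c c' → UWString c [] c'
  | cons {c a c₁ s c'} : UWAct c a c₁ → UWString c₁ s c' → UWString c (a :: s) c'


/-- if `p ≼^𝕀 q`, `s ∈ tr(q)` and `p ⇓ [s]_D`, then some `s' ∈ [s]_D`
is a trace of `p`. -/
theorem traceLeqUnc_trace_implication (Name : Type) [Countable Name] {n : ℕ}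
    (𝕀 : Interface Name n) (p q : Proc Name) (h : TraceLeqUnc 𝕀 p q)
    (s : List (Act Name)) (hs : s ∈ Tr (Conf.proc q))
    (hp : ConvMC (Conf.proc p) (DepOf 𝕀) s) :
    ∃ s', MEquiv (DepOf 𝕀) s s' ∧ s' ∈ Tr (Conf.proc p) := by
  by_contra hne
  obtain ⟨c, hc⟩ := hs
  have hpm : MUSTset (afterMC (Conf.proc p) (DepOf 𝕀) s) ∅ :=
    fun d ⟨t, hst, ht⟩ => (hne ⟨t, hst, d, ht⟩).elim
  have hqm := (h s 0 ∅ Set.finite_empty (Set.empty_subset _) hp).2 hpm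
  obtain ⟨a, ha, -⟩ := hqm c ⟨s, Relation.EqvGen.refl s, hc⟩ c Relation.ReflTransGen.refl
  exact ha

end MultipartyTesting
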